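/- Let m be a positive integer, α = (α₁, …, α_m) an m-tuple of real numbers, and n ≥ 2 an integer. For a positive integer q define ℓ(q) = √(Σ_{i=1}^m ‖qαᵢ‖²). Let Q₁ be the least integer in {1, …, ⌊n/2⌋} such that ℓ(Q₁) ≤ ℓ(q) for all integers 1 ≤ q ≤ n/2. Then the number of integers q with n/2 < q ≤ n and ℓ(q) < ℓ(Q₁) is at most (2⌈√m⌉)^m. -/

import Mathlib

/-- `nint x` is the distance from the real number `x` to the nearest integer. -/
noncomputable def nint (x : ℝ) : ℝ := |x - round x|

/-- `lenm α q = √(Σᵢ ‖qαᵢ‖²)`, the length of the integer `q` w.r.t. `α : Fin m → ℝ`. -/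
noncomputable def lenm {m : ℕ} (α : Fin m → ℝ) (q : ℕ) : ℝ :=
  Real.sqrt (∑ i, nint ((q : ℝ) * α i) ^ 2)

lemma nint_sub_le (x y : ℝ) : nint (x - y) ≤ |(x - round x) - (y - round y)| := by
  have h := round_le (x - y) (round x - round y)
  have e : x - y - ((round x - round y : ℤ) : ℝ) = (x - round x) - (y - round y) := by
    push_cast
    ring
  rwa [e] at h

lemma nint_le_lenm {m : ℕ} (α : Fin m → ℝ) (q : ℕ) (i : Fin m) :
    nint ((q : ℝ) * α i) ≤ lenm α q :=
  Real.le_sqrt_of_sq_le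
    (Finset.single_le_sum (f := fun j => nint ((q : ℝ) * α j) ^ 2)
      (fun _ _ => sq_nonneg _) (Finset.mem_univ i))

/-- If the residues of `a * α i` and `b * α i` modulo `1` lie, for every `i`, in a common
half-open interval of length `L / k` with `√m ≤ k`, then `b - a` has length less than `L`. -/
lemma lenm_sub_lt_of_floor_eq {m k : ℕ} (hm : 1 ≤ m) (α : Fin m → ℝ) {L : ℝ} (hL : 0 < L)
    (hk : Real.sqrt m ≤ k) {a b : ℕ} (hab : a ≤ b)
    (h : ∀ i, ⌊((b : ℝ) * α i - round ((b : ℝ) * α i)) * k / L⌋ =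
      ⌊((a : ℝ) * α i - round ((a : ℝ) * α i)) * k / L⌋) :
    lenm α (b - a) < L := by
  have hm0 : (0 : ℝ) < m := by exact_mod_cast hm
  have hk0 : (0 : ℝ) < k := (Real.sqrt_pos.2 hm0).trans_le hk
  have hmk : (m : ℝ) ≤ (k : ℝ) ^ 2 := (Real.sqrt_le_left hk0.le).1 hk
  have hcoord (i : Fin m) : nint (((b - a : ℕ) : ℝ) * α i) ^ 2 < (L / k) ^ 2 := by
    have h1 := Int.abs_sub_lt_one_of_floor_eq_floor (h i)
    rw [← sub_div, ← sub_mul, abs_div, abs_mul, abs_of_pos hL, abs_of_pos hk0,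
      div_lt_one hL, ← lt_div_iff₀ hk0] at h1
    have h2 := nint_sub_le ((b : ℝ) * α i) ((a : ℝ) * α i)
    rw [← sub_mul, ← Nat.cast_sub hab] at h2
    exact pow_lt_pow_left₀ (h2.trans_lt h1) (abs_nonneg _) two_ne_zero
  have : Nonempty (Fin m) := ⟨⟨0, hm⟩⟩
  rw [lenm, Real.sqrt_lt' hL]
  calc ∑ i, nint (((b - a : ℕ) : ℝ) * α i) ^ 2
      < ∑ _i : Fin m, (L / k) ^ 2 :=
        Finset.sum_lt_sum_of_nonempty Finset.univ_nonempty fun i _ => hcoord i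
    _ = m * L ^ 2 / k ^ 2 := by
        simp [div_pow, mul_div_assoc]
    _ ≤ L ^ 2 := by
        rw [div_le_iff₀ (by positivity), mul_comm]
        gcongr

/-- Lemma 3 of the paper: if `Q₁` is the least integer in `{1, …, ⌊n/2⌋}` minimising the
length `ℓ` among `1 ≤ q ≤ n/2`, then the number of primary denominators
(`n/2 < q ≤ n` with `ℓ(q) < ℓ(Q₁)`) is at most `(2⌈√m⌉)^m`. -/
theorem primary_denominators_count (m : ℕ) (hm : 1 ≤ m) (α : Fin m → ℝ)
    (n : ℕ) (hn : 2 ≤ n) (Q₁ : ℕ)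
    (hQ₁ : IsLeast {q : ℕ | (1 ≤ q ∧ 2 * q ≤ n) ∧
      ∀ q' : ℕ, 1 ≤ q' → 2 * q' ≤ n → lenm α q ≤ lenm α q'} Q₁) :
    Set.ncard {q : ℕ | n < 2 * q ∧ q ≤ n ∧ lenm α q < lenm α Q₁}
      ≤ (2 * ⌈Real.sqrt m⌉₊) ^ m := by
  obtain ⟨⟨-, hmin⟩, -⟩ := hQ₁
  set L := lenm α Q₁
  set k := ⌈Real.sqrt m⌉₊
  have hk : Real.sqrt m ≤ k := Nat.le_ceil _
  have hk0 : (0 : ℝ) < k :=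
    (Real.sqrt_pos.2 (by exact_mod_cast hm : (0 : ℝ) < m)).trans_le hk
  let cell (q : ℕ) (i : Fin m) : ℤ := ⌊((q : ℝ) * α i - round ((q : ℝ) * α i)) * k / L⌋
  let cells : Finset (Fin m → ℤ) := Fintype.piFinset fun _ => Finset.Ico (-k : ℤ) k
  have hcard : (cells : Set (Fin m → ℤ)).ncard = (2 * k) ^ m := by
    rw [Set.ncard_coe_finset, Fintype.card_piFinset_const, Int.card_Ico]
    congr 1
    omega
  have hpos {q : ℕ} (hq : lenm α q < L) : 0 < L := (Real.sqrt_nonneg _).trans_lt hq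
  have hinj {a b : ℕ} (ha : n < 2 * a) (hb : b ≤ n) (hL : 0 < L) (hab : a < b)
      (h : cell b = cell a) : False :=
    (lenm_sub_lt_of_floor_eq hm α hL hk hab.le fun i => congrFun h i).not_ge
      (hmin (b - a) (by omega) (by omega))
  rw [← hcard]
  refine Set.ncard_le_ncard_of_injOn cell ?_ ?_ cells.finite_toSet
  · rintro q ⟨-, -, hq⟩
    have hL := hpos hq
    simp only [cells, Finset.mem_coe, Fintype.mem_piFinset, Finset.mem_Ico]
    intro i
    obtain ⟨h1, h2⟩ := abs_lt.1 ((nint_le_lenm α q i).trans_lt hq)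
    constructor
    · rw [Int.le_floor, le_div_iff₀ hL]
      push_cast
      nlinarith
    · rw [Int.floor_lt, div_lt_iff₀ hL]
      push_cast
      nlinarith
  · rintro a ⟨ha, ha', hla⟩ b ⟨hb, hb', -⟩ h
    rcases lt_trichotomy a b with hab | hab | hab
    · exact (hinj ha hb' (hpos hla) hab h.symm).elim
    · exact hab
    · exact (hinj hb ha' (hpos hla) hab h).elim
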